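/- Let T > 0, γ > 0, let A, B, D ∈ ℝ^{2×2}, C ∈ ℝ², Q ∈ ℝ^{2×2} symmetric positive semidefinite, R ∈ ℝ^{2×2} symmetric positive definite, φ ∈ ℝ^{2×2} symmetric, and L : [0,T] → ℝ² continuous. Write E := −BR⁻¹Bᵀ + γ⁻²DDᵀ. Suppose P : [0,T] → ℝ^{2×2} (symmetric-valued), Ψ : [0,T] → ℝ² and χ : [0,T] → ℝ are differentiable and satisfy: P'(t) + P(t)A + AᵀP(t) + P(t)E P(t) + Q = 0 with P(T) = φ; Ψ'(t) + AᵀΨ(t) + P(t)C + P(t)E Ψ(t) + L(t) = 0 with Ψ(T) = 0; and χ'(t) + Ψ(t)ᵀC + (1/2)Ψ(t)ᵀE Ψ(t) = 0 with χ(T) = 0, and set v(X,t) = (1/2)XᵀP(t)X + Ψ(t)ᵀX + χ(t). Let w : [0,T] → ℝ² be any continuous disturbance, and let X : [0,T] → ℝ² be a differentiable trajectory satisfying X'(t) = AX(t) + Bu*(t) + C + Dw(t) where u*(t) = −R⁻¹Bᵀ(P(t)X(t) + Ψ(t)). Then the disturbance-penalized cost ∫₀ᵀ [ (1/2)X(t)ᵀQX(t)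 + (1/2)u*(t)ᵀRu*(t) − (γ²/2)‖w(t)‖² + L(t)ᵀX(t) ] dt + (1/2)X(T)ᵀφX(T) is at most v(X(0),0), with equality if w(t) = γ⁻²Dᵀ(P(t)X(t) + Ψ(t)) for all t ∈ [0,T]. -/

import Mathlib

open Matrix Set

lemma aux_hjb (A E Q P P' : Matrix (Fin 2) (Fin 2) ℝ) (C L S S' X : Fin 2 → ℝ) (c' : ℝ)
    (hE : E.IsSymm) (hP : P.IsSymm)
    (h1 : P' + P * A + Aᵀ * P + P * E * P + Q = 0)
    (h2 : S' + Aᵀ *ᵥ S + P *ᵥ C + (P * E) *ᵥ S + L = 0)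
    (h3 : c' + S ⬝ᵥ C + (1 / 2) * (S ⬝ᵥ (E *ᵥ S)) = 0) :
    (1 / 2) * (X ⬝ᵥ (P' *ᵥ X)) + S' ⬝ᵥ X + c' =
      -((P *ᵥ X + S) ⬝ᵥ (A *ᵥ X) + (P *ᵥ X + S) ⬝ᵥ C
        + (1 / 2) * ((P *ᵥ X + S) ⬝ᵥ (E *ᵥ (P *ᵥ X + S)))
        + (1 / 2) * (X ⬝ᵥ (Q *ᵥ X)) + L ⬝ᵥ X) := by
  have e1 : P' = -(P * A + Aᵀ * P + P * E * P + Q) := by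
    rw [eq_neg_iff_add_eq_zero, ← h1]; abel
  have e2 : S' = -(Aᵀ *ᵥ S + P *ᵥ C + (P * E) *ᵥ S + L) := by
    rw [eq_neg_iff_add_eq_zero, ← h2]; abel
  have e3 : c' = -(S ⬝ᵥ C + (1 / 2) * (S ⬝ᵥ (E *ᵥ S))) := by linarith
  have hE' : E 1 0 = E 0 1 := hE.apply 0 1
  have hP' : P 1 0 = P 0 1 := hP.apply 0 1
  subst e1 e2 e3
  simp only [dotProduct, mulVec, Matrix.mul_apply, Fin.sum_univ_two, Matrix.add_apply,
    Matrix.neg_apply, Pi.add_apply, Pi.neg_apply, Matrix.transpose_apply, hE', hP']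
  ring

lemma aux_u (B R : Matrix (Fin 2) (Fin 2) ℝ) (hR : R.PosDef) (y : Fin 2 → ℝ) :
    (-((R⁻¹ * Bᵀ) *ᵥ y)) ⬝ᵥ (R *ᵥ (-((R⁻¹ * Bᵀ) *ᵥ y))) = y ⬝ᵥ ((B * R⁻¹ * Bᵀ) *ᵥ y) := by
  have hu : IsUnit R.det := hR.det_pos.ne'.isUnit
  have hs : (R⁻¹)ᵀ = R⁻¹ := by
    have := hR.inv.isHermitian
    simpa [Matrix.IsHermitian, Matrix.conjTranspose_eq_transpose_of_trivial] using this
  rw [mulVec_neg, neg_dotProduct_neg, mulVec_mulVec, ← Matrix.mul_assoc,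
    Matrix.mul_nonsing_inv _ hu, Matrix.one_mul, dotProduct_comm, dotProduct_mulVec,
    ← mulVec_transpose, dotProduct_comm, mulVec_mulVec, Matrix.transpose_mul, hs,
    Matrix.transpose_transpose]

lemma aux_sq (γ : ℝ) (hγ : 0 < γ) (D : Matrix (Fin 2) (Fin 2) ℝ) (y w : Fin 2 → ℝ) :
    y ⬝ᵥ (D *ᵥ w) - (1 / 2) * (y ⬝ᵥ (((γ ^ 2)⁻¹ • (D * Dᵀ)) *ᵥ y)) =
      (γ ^ 2 / 2) * (w ⬝ᵥ w) - (γ ^ 2 / 2) *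
        ((w - (γ ^ 2)⁻¹ • (Dᵀ *ᵥ y)) ⬝ᵥ (w - (γ ^ 2)⁻¹ • (Dᵀ *ᵥ y))) := by
  simp only [dotProduct, mulVec, Matrix.mul_apply, Fin.sum_univ_two, Matrix.smul_apply,
    Pi.sub_apply, Pi.smul_apply, Matrix.transpose_apply, smul_eq_mul]
  field_simp
  ring

theorem stmt_14
    (T : ℝ) (hT : 0 < T) (γ : ℝ) (hγ : 0 < γ)
    (A B D : Matrix (Fin 2) (Fin 2) ℝ) (C : Fin 2 → ℝ)
    (Q R φ : Matrix (Fin 2) (Fin 2) ℝ)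
    (hQ : Q.PosSemidef) (hR : R.PosDef) (hφ : φ.IsSymm)
    (L : ℝ → Fin 2 → ℝ) (hL : ContinuousOn L (Icc 0 T))
    (E : Matrix (Fin 2) (Fin 2) ℝ) (hE : E = -(B * R⁻¹ * Bᵀ) + (γ ^ 2)⁻¹ • (D * Dᵀ))
    (P P' : ℝ → Matrix (Fin 2) (Fin 2) ℝ)
    (Ψ Ψ' : ℝ → Fin 2 → ℝ) (χ χ' : ℝ → ℝ)
    (hPsymm : ∀ t ∈ Icc (0:ℝ) T, (P t).IsSymm)
    (hPdiff : ∀ t ∈ Icc (0:ℝ) T, ∀ i j,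
      HasDerivWithinAt (fun s => P s i j) (P' t i j) (Icc 0 T) t)
    (hΨdiff : ∀ t ∈ Icc (0:ℝ) T, HasDerivWithinAt Ψ (Ψ' t) (Icc 0 T) t)
    (hχdiff : ∀ t ∈ Icc (0:ℝ) T, HasDerivWithinAt χ (χ' t) (Icc 0 T) t)
    (hPeq : ∀ t ∈ Icc (0:ℝ) T,
      P' t + P t * A + Aᵀ * P t + P t * E * P t + Q = 0)
    (hPT : P T = φ)
    (hΨeq : ∀ t ∈ Icc (0:ℝ) T,
      Ψ' t + Aᵀ *ᵥ Ψ t + P t *ᵥ C + (P t * E) *ᵥ Ψ t + L t = 0)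
    (hΨT : Ψ T = 0)
    (hχeq : ∀ t ∈ Icc (0:ℝ) T,
      χ' t + Ψ t ⬝ᵥ C + (1 / 2) * (Ψ t ⬝ᵥ (E *ᵥ Ψ t)) = 0)
    (hχT : χ T = 0) :
    ∀ (w X : ℝ → Fin 2 → ℝ),
      ContinuousOn w (Icc 0 T) →
      (∀ t ∈ Icc (0:ℝ) T,
        HasDerivWithinAt X
          (A *ᵥ X t + B *ᵥ (-((R⁻¹ * Bᵀ) *ᵥ (P t *ᵥ X t + Ψ t))) + C + D *ᵥ w t)
          (Icc 0 T) t) →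
      ((∫ t in (0:ℝ)..T,
          ((1 / 2) * (X t ⬝ᵥ (Q *ᵥ X t))
            + (1 / 2) * ((-((R⁻¹ * Bᵀ) *ᵥ (P t *ᵥ X t + Ψ t))) ⬝ᵥ
                (R *ᵥ (-((R⁻¹ * Bᵀ) *ᵥ (P t *ᵥ X t + Ψ t)))))
            - (γ ^ 2 / 2) * (w t ⬝ᵥ w t) + L t ⬝ᵥ X t))
          + (1 / 2) * (X T ⬝ᵥ (φ *ᵥ X T))
        ≤ (1 / 2) * (X 0 ⬝ᵥ (P 0 *ᵥ X 0)) + Ψ 0 ⬝ᵥ X 0 + χ 0) ∧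
      ((∀ t ∈ Icc (0:ℝ) T, w t = (γ ^ 2)⁻¹ • (Dᵀ *ᵥ (P t *ᵥ X t + Ψ t))) →
        (∫ t in (0:ℝ)..T,
          ((1 / 2) * (X t ⬝ᵥ (Q *ᵥ X t))
            + (1 / 2) * ((-((R⁻¹ * Bᵀ) *ᵥ (P t *ᵥ X t + Ψ t))) ⬝ᵥ
                (R *ᵥ (-((R⁻¹ * Bᵀ) *ᵥ (P t *ᵥ X t + Ψ t)))))
            - (γ ^ 2 / 2) * (w t ⬝ᵥ w t) + L t ⬝ᵥ X t))
          + (1 / 2) * (X T ⬝ᵥ (φ *ᵥ X T))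
          = (1 / 2) * (X 0 ⬝ᵥ (P 0 *ᵥ X 0)) + Ψ 0 ⬝ᵥ X 0 + χ 0) := by
  intro w X hw hX
  have hEs : E.IsSymm := by
    have hs : (R⁻¹)ᵀ = R⁻¹ := by
      have := hR.inv.isHermitian
      simpa [Matrix.IsHermitian, Matrix.conjTranspose_eq_transpose_of_trivial] using this
    rw [Matrix.IsSymm, hE]
    simp only [transpose_add, transpose_neg, transpose_mul, transpose_smul, transpose_transpose,
      hs, Matrix.mul_assoc]
  set g : ℝ → ℝ := fun t => ((1 / 2) * (X t ⬝ᵥ (Q *ᵥ X t))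
            + (1 / 2) * ((-((R⁻¹ * Bᵀ) *ᵥ (P t *ᵥ X t + Ψ t))) ⬝ᵥ
                (R *ᵥ (-((R⁻¹ * Bᵀ) *ᵥ (P t *ᵥ X t + Ψ t)))))
            - (γ ^ 2 / 2) * (w t ⬝ᵥ w t) + L t ⬝ᵥ X t) with hg
  set z : ℝ → Fin 2 → ℝ := fun t => w t - (γ ^ 2)⁻¹ • (Dᵀ *ᵥ (P t *ᵥ X t + Ψ t)) with hz
  set d : ℝ → ℝ := fun t => (γ ^ 2 / 2) * (z t ⬝ᵥ z t) with hd
  set V : ℝ → ℝ := fun t => (1 / 2) * (X t ⬝ᵥ (P t *ᵥ X t)) + Ψ t ⬝ᵥ X t + χ t with hV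
  have hderiv : ∀ t ∈ Icc (0:ℝ) T, HasDerivWithinAt V (-(g t + d t)) (Icc 0 T) t := by
    intro t ht
    have hx := hasDerivWithinAt_pi.1 (hX t ht)
    have hp := hasDerivWithinAt_pi.1 (hΨdiff t ht)
    have hP := hPdiff t ht
    have key := aux_hjb A E Q (P t) (P' t) C (L t) (Ψ t) (Ψ' t) (X t) (χ' t) hEs (hPsymm t ht)
      (hPeq t ht) (hΨeq t ht) (hχeq t ht)
    have hu := aux_u B R hR (P t *ᵥ X t + Ψ t)
    have hsq := aux_sq γ hγ D (P t *ᵥ X t + Ψ t) (w t)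
    have hBu : B *ᵥ (-((R⁻¹ * Bᵀ) *ᵥ (P t *ᵥ X t + Ψ t))) =
        -((B * R⁻¹ * Bᵀ) *ᵥ (P t *ᵥ X t + Ψ t)) := by
      rw [mulVec_neg, mulVec_mulVec, Matrix.mul_assoc]
    have hEy : (P t *ᵥ X t + Ψ t) ⬝ᵥ (E *ᵥ (P t *ᵥ X t + Ψ t)) =
        -((P t *ᵥ X t + Ψ t) ⬝ᵥ ((B * R⁻¹ * Bᵀ) *ᵥ (P t *ᵥ X t + Ψ t)))
        + (P t *ᵥ X t + Ψ t) ⬝ᵥ (((γ ^ 2)⁻¹ • (D * Dᵀ)) *ᵥ (P t *ᵥ X t + Ψ t)) := by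
      rw [hE, add_mulVec, neg_mulVec, dotProduct_add, dotProduct_neg]
    have hval : (1 / 2) * (X t ⬝ᵥ (P' t *ᵥ X t)) + Ψ' t ⬝ᵥ X t + χ' t
        + (P t *ᵥ X t + Ψ t) ⬝ᵥ
          (A *ᵥ X t + B *ᵥ (-((R⁻¹ * Bᵀ) *ᵥ (P t *ᵥ X t + Ψ t))) + C + D *ᵥ w t)
        = -(g t + d t) := by
      simp only [hg, hd, hz]
      rw [key, hu, hBu, hEy, dotProduct_add, dotProduct_add, dotProduct_add, dotProduct_neg]
      linarith
    have hsymm : P t 1 0 = P t 0 1 := (hPsymm t ht).apply 0 1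
    rw [← hval]
    generalize (A *ᵥ X t + B *ᵥ (-((R⁻¹ * Bᵀ) *ᵥ (P t *ᵥ X t + Ψ t))) + C + D *ᵥ w t) = X' at hx
    have hform : V = fun t => (1 / 2) * (X t 0 * (P t 0 0 * X t 0 + P t 0 1 * X t 1)
        + X t 1 * (P t 1 0 * X t 0 + P t 1 1 * X t 1))
        + (Ψ t 0 * X t 0 + Ψ t 1 * X t 1) + χ t := by
      funext s
      simp only [hV, dotProduct, mulVec, Fin.sum_univ_two]
    rw [hform]
    have := (((((hx 0).mul (((hP 0 0).mul (hx 0)).add ((hP 0 1).mul (hx 1)))).add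
      ((hx 1).mul (((hP 1 0).mul (hx 0)).add ((hP 1 1).mul (hx 1))))).const_mul (1 / 2)).add
      (((hp 0).mul (hx 0)).add ((hp 1).mul (hx 1)))).add (hχdiff t ht)
    refine this.congr_deriv ?_
    simp only [dotProduct, mulVec, Fin.sum_univ_two, Pi.add_apply, Pi.mul_apply, hsymm]
    ring
  have cX : ∀ i, ContinuousOn (fun t => X t i) (Icc 0 T) := fun i t ht =>
    (hasDerivWithinAt_pi.1 (hX t ht) i).continuousWithinAt
  have cΨ : ∀ i, ContinuousOn (fun t => Ψ t i) (Icc 0 T) := fun i t ht =>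
    (hasDerivWithinAt_pi.1 (hΨdiff t ht) i).continuousWithinAt
  have cP : ∀ i j, ContinuousOn (fun t => P t i j) (Icc 0 T) := fun i j t ht =>
    (hPdiff t ht i j).continuousWithinAt
  have cw : ∀ i, ContinuousOn (fun t => w t i) (Icc 0 T) := continuousOn_pi.1 hw
  have cL : ∀ i, ContinuousOn (fun t => L t i) (Icc 0 T) := continuousOn_pi.1 hL
  have cg : ContinuousOn g (Icc 0 T) := by
    simp only [hg, dotProduct, mulVec, Fin.sum_univ_two, Pi.add_apply, Pi.neg_apply]
    fun_prop
  have cd : ContinuousOn d (Icc 0 T) := by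
    simp only [hd, hz, dotProduct, mulVec, Fin.sum_univ_two, Pi.add_apply, Pi.sub_apply,
      Pi.smul_apply, smul_eq_mul]
    fun_prop
  have ig : IntervalIntegrable g MeasureTheory.volume 0 T :=
    ContinuousOn.intervalIntegrable_of_Icc hT.le cg
  have id' : IntervalIntegrable d MeasureTheory.volume 0 T :=
    ContinuousOn.intervalIntegrable_of_Icc hT.le cd
  have ftc : ∫ t in (0:ℝ)..T, -(g t + d t) = V T - V 0 :=
    intervalIntegral.integral_eq_sub_of_hasDerivAt_of_le hT.le
      (fun t ht => (hderiv t ht).continuousWithinAt)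
      (fun t ht => (hderiv t (Ioo_subset_Icc_self ht)).hasDerivAt (Icc_mem_nhds ht.1 ht.2))
      (ig.add id').neg
  rw [intervalIntegral.integral_neg, intervalIntegral.integral_add ig id'] at ftc
  have hVT : V T = (1 / 2) * (X T ⬝ᵥ (φ *ᵥ X T)) := by
    simp [hV, hPT, hΨT, hχT]
  have hV0 : (1 / 2) * (X 0 ⬝ᵥ (P 0 *ᵥ X 0)) + Ψ 0 ⬝ᵥ X 0 + χ 0 = V 0 := rfl
  rw [hV0, ← hVT]
  constructor
  · have : 0 ≤ ∫ t in (0:ℝ)..T, d t := by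
      apply intervalIntegral.integral_nonneg hT.le
      intro t _
      simp only [hd, dotProduct, Fin.sum_univ_two]
      nlinarith [mul_nonneg (sq_nonneg γ) (add_nonneg (mul_self_nonneg (z t 0)) (mul_self_nonneg (z t 1)))]
    linarith
  · intro hw'
    have : ∫ t in (0:ℝ)..T, d t = ∫ t in (0:ℝ)..T, (0:ℝ) := by
      apply intervalIntegral.integral_congr
      intro t ht
      rw [uIcc_of_le hT.le] at ht
      have : z t = 0 := by simp only [hz]; rw [← hw' t ht, sub_self]
      simp [hd, this]
    rw [intervalIntegral.integral_zero] at this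
    linarith
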